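/- arXiv:1512.04990 — 2 statements merged into one kernel-verified Lean document; each statement's English description precedes it below -/
import Mathlib

section
/- (First Main Theorem, Theorem 3.2.5, in adapted coordinates.) The directional shape operator satisfies L_{Z_v} A_Z = −(A_Z)² − i_{Z_v}(Z^φ Φ_+ + Z^φ r_+); in components, for every σ, ν, at every point of ℝⁿ × ℝᵐ, the following sum of five expressions vanishes: T1 + T2 + T3 + T4 + T5 = 0, where T1 = Σ_{i,k} v^i (∂v^k/∂x^i)(∂Z_k^σ/∂y^ν − H̄_{νk}^σ); T2 = Σ_{i,k} v^i v^k [ Z_i(∂Z_k^σ/∂y^ν) − Z_i(H̄_{νk}^σ) + Σ_ρ (∂Z_k^σ/∂y^ρ − H̄_{ρk}^σ)(∂Z_i^ρ/∂y^ν) − Σ_ρ (∂Z_k^ρ/∂y^ν − H̄_{νk}^ρ)(∂Z_i^σ/∂y^ρ) ]; T3 = Σ_{i,k,ρ} v^i v^k [ (∂Z_i^σ/∂y^ρ)(∂Z_k^ρ/∂y^ν) − H̄_{ρi}^σ (∂Z_k^ρ/∂y^ν) − H̄_{νk}^ρ (∂Z_i^σ/∂y^ρ) + H̄_{ρi}^σ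 H̄_{νk}^ρ ]; T4 = Σ_i v^i Φ̄_{iν}^σ with Φ_{iν}^σ = Σ_k v^k (Γ_i(H_{νk}^σ) − H_ν(F_{ik}^σ) + Σ_ρ H_{νi}^ρ H_{ρk}^σ) and Φ̄ = Φ ∘ s; T5 = Σ_{i,k,p≥2,ρ} v^i v^k ((v^p ∂F_{ik}^σ/∂y_1^ρ − ∂F_{ik}^σ/∂y_p^ρ) ∘ s)·(∂Z_p^ρ/∂y^ν − H̄_{νp}^ρ) − Σ_{i,p≥2} v^i (∂v^p/∂x^i)(∂Z_p^σ/∂y^ν − H̄_{νp}^σ). -/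
open scoped BigOperators

/-- Partial derivative in the base coordinate `x^i` of a function on
`ℝⁿ × ℝᵐ × ℝ^{nm}` (coordinates `(x^i, y^σ, y_j^σ)`). -/
noncomputable def pdx {n m : ℕ} (i : Fin n)
    (f : (Fin n → ℝ) × (Fin m → ℝ) × (Fin n → Fin m → ℝ) → ℝ)
    (w : (Fin n → ℝ) × (Fin m → ℝ) × (Fin n → Fin m → ℝ)) : ℝ :=
  deriv (fun t => f (Function.update w.1 i t, w.2.1, w.2.2)) (w.1 i)

/-- Partial derivative in the fibre coordinate `y^σ` of a function on `ℝⁿ × ℝᵐ × ℝ^{nm}`. -/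
noncomputable def pdy {n m : ℕ} (σ : Fin m)
    (f : (Fin n → ℝ) × (Fin m → ℝ) × (Fin n → Fin m → ℝ) → ℝ)
    (w : (Fin n → ℝ) × (Fin m → ℝ) × (Fin n → Fin m → ℝ)) : ℝ :=
  deriv (fun t => f (w.1, Function.update w.2.1 σ t, w.2.2)) (w.2.1 σ)

/-- Partial derivative in the derivative coordinate `y_j^σ` of a function on
`ℝⁿ × ℝᵐ × ℝ^{nm}`. -/
noncomputable def pdyj {n m : ℕ} (j : Fin n) (σ : Fin m)
    (f : (Fin n → ℝ) × (Fin m → ℝ) × (Fin n → Fin m → ℝ) → ℝ)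
    (w : (Fin n → ℝ) × (Fin m → ℝ) × (Fin n → Fin m → ℝ)) : ℝ :=
  deriv (fun t =>
    f (w.1, w.2.1, Function.update w.2.2 j (Function.update (w.2.2 j) σ t))) (w.2.2 j σ)

/-- Partial derivative in the `i`-th coordinate of a function on `ℝⁿ`. -/
noncomputable def xd {n : ℕ} (i : Fin n) (g : (Fin n → ℝ) → ℝ) (x : Fin n → ℝ) : ℝ :=
  deriv (fun t => g (Function.update x i t)) (x i)

/-- Partial derivative in the `i`-th base coordinate `x^i` of a function on `ℝⁿ × ℝᵐ`. -/
noncomputable def qdx {n m : ℕ} (i : Fin n) (g : (Fin n → ℝ) × (Fin m → ℝ) → ℝ)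
    (p : (Fin n → ℝ) × (Fin m → ℝ)) : ℝ :=
  deriv (fun t => g (Function.update p.1 i t, p.2)) (p.1 i)

/-- Partial derivative in the fibre coordinate `y^σ` of a function on `ℝⁿ × ℝᵐ`. -/
noncomputable def qdy {n m : ℕ} (σ : Fin m) (g : (Fin n → ℝ) × (Fin m → ℝ) → ℝ)
    (p : (Fin n → ℝ) × (Fin m → ℝ)) : ℝ :=
  deriv (fun t => g (p.1, Function.update p.2 σ t)) (p.2 σ)

/-- The vector field `Z_i = ∂/∂x^i + Z_i^σ ∂/∂y^σ` acting on functions on `ℝⁿ × ℝᵐ`. -/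
noncomputable def Zop {n m : ℕ} (Z : Fin n → Fin m → (Fin n → ℝ) × (Fin m → ℝ) → ℝ)
    (i : Fin n) (g : (Fin n → ℝ) × (Fin m → ℝ) → ℝ)
    (p : (Fin n → ℝ) × (Fin m → ℝ)) : ℝ :=
  qdx i g p + ∑ σ, Z i σ p * qdy σ g p

/-- The section `s(x,y) = (x, y, Z_j^ν(x,y))` associated with a first-order connection `Z`. -/
def sec {n m : ℕ} (Z : Fin n → Fin m → (Fin n → ℝ) × (Fin m → ℝ) → ℝ)
    (p : (Fin n → ℝ) × (Fin m → ℝ)) :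
    (Fin n → ℝ) × (Fin m → ℝ) × (Fin n → Fin m → ℝ) :=
  (p.1, p.2, fun j ν => Z j ν p)

/-- The operator `Γ_i = ∂/∂x^i + y_i^σ ∂/∂y^σ + F_{ij}^σ ∂/∂y_j^σ` acting on
functions on `ℝⁿ × ℝᵐ × ℝ^{nm}`. -/
noncomputable def Gammaop {n m : ℕ}
    (F : Fin n → Fin n → Fin m →
      (Fin n → ℝ) × (Fin m → ℝ) × (Fin n → Fin m → ℝ) → ℝ)
    (i : Fin n)
    (f : (Fin n → ℝ) × (Fin m → ℝ) × (Fin n → Fin m → ℝ) → ℝ)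
    (w : (Fin n → ℝ) × (Fin m → ℝ) × (Fin n → Fin m → ℝ)) : ℝ :=
  pdx i f w + ∑ σ, w.2.2 i σ * pdy σ f w + ∑ j, ∑ σ, F i j σ w * pdyj j σ f w

/-- The semi-horizontal components `H_{σk}^ν` determined by `F` and `v` in
adapted coordinates (`φ = dx¹`, index `1` realised as `0 : Fin n`):
`H_{σ1}^ν = ½(∂F_{11}^ν/∂y_1^σ − Σ_{p,q≥2} v^p v^q ∂F_{pq}^ν/∂y_1^σ)` and
`H_{σp}^ν = Σ_k v^k ∂F_{pk}^ν/∂y_1^σ` for `p ≥ 2`. -/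
noncomputable def Hfun {n m : ℕ} [NeZero n]
    (F : Fin n → Fin n → Fin m →
      (Fin n → ℝ) × (Fin m → ℝ) × (Fin n → Fin m → ℝ) → ℝ)
    (v : Fin n → (Fin n → ℝ) → ℝ)
    (σ : Fin m) (k : Fin n) (ν : Fin m)
    (w : (Fin n → ℝ) × (Fin m → ℝ) × (Fin n → Fin m → ℝ)) : ℝ :=
  if k = 0 then
    (1 / 2) * (pdyj 0 σ (F 0 0 ν) w
      - ∑ p ∈ Finset.univ.erase (0 : Fin n), ∑ q ∈ Finset.univ.erase (0 : Fin n),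
          v p w.1 * v q w.1 * pdyj 0 σ (F p q ν) w)
  else
    ∑ j, v j w.1 * pdyj 0 σ (F k j ν) w

/-- The operator `H_ν = ∂/∂y^ν + H_{νk}^σ ∂/∂y_k^σ` acting on functions on
`ℝⁿ × ℝᵐ × ℝ^{nm}`. -/
noncomputable def Hop {n m : ℕ}
    (H : Fin m → Fin n → Fin m →
      (Fin n → ℝ) × (Fin m → ℝ) × (Fin n → Fin m → ℝ) → ℝ)
    (ν : Fin m)
    (f : (Fin n → ℝ) × (Fin m → ℝ) × (Fin n → Fin m → ℝ) → ℝ)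
    (w : (Fin n → ℝ) × (Fin m → ℝ) × (Fin n → Fin m → ℝ)) : ℝ :=
  pdy ν f w + ∑ k, ∑ σ, H ν k σ w * pdyj k σ f w

/-- The components `Φ_{iν}^σ = Σ_k v^k (Γ_i(H_{νk}^σ) − H_ν(F_{ik}^σ) + Σ_ρ H_{νi}^ρ H_{ρk}^σ)`
of the partial Jacobi endomorphism. -/
noncomputable def Phi {n m : ℕ} [NeZero n]
    (F : Fin n → Fin n → Fin m →
      (Fin n → ℝ) × (Fin m → ℝ) × (Fin n → Fin m → ℝ) → ℝ)
    (v : Fin n → (Fin n → ℝ) → ℝ)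
    (i : Fin n) (ν : Fin m) (σ : Fin m)
    (w : (Fin n → ℝ) × (Fin m → ℝ) × (Fin n → Fin m → ℝ)) : ℝ :=
  ∑ k, v k w.1 *
    (Gammaop F i (Hfun F v ν k σ) w - Hop (Hfun F v) ν (F i k σ) w
      + ∑ ρ, Hfun F v ν i ρ w * Hfun F v ρ k σ w)

section helpers

open Finset

lemma fmt_hasDerivAt_update {n : ℕ} (x : Fin n → ℝ) (i : Fin n) (t : ℝ) :
    HasDerivAt (fun t => Function.update x i t) (Pi.single i (1 : ℝ)) t :=
  hasDerivAt_update x i t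

lemma fmt_pdx {n m : ℕ} (i : Fin n)
    {f : (Fin n → ℝ) × (Fin m → ℝ) × (Fin n → Fin m → ℝ) → ℝ} (hf : Differentiable ℝ f)
    (w : (Fin n → ℝ) × (Fin m → ℝ) × (Fin n → Fin m → ℝ)) :
    pdx i f w = fderiv ℝ f w (Pi.single i 1, 0, 0) := by
  have hc : HasDerivAt (fun t : ℝ => ((Function.update w.1 i t, w.2.1, w.2.2) :
      (Fin n → ℝ) × (Fin m → ℝ) × (Fin n → Fin m → ℝ))) (Pi.single i 1, 0, 0) (w.1 i) :=
    (hasDerivAt_update w.1 i (w.1 i)).prodMk (hasDerivAt_const _ (w.2.1, w.2.2))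
  have h2 := (hf (Function.update w.1 i (w.1 i), w.2.1, w.2.2)).hasFDerivAt.comp_hasDerivAt (w.1 i) hc
  have := h2.deriv
  simp only [Function.update_eq_self] at this
  exact this

lemma fmt_pdy {n m : ℕ} (σ : Fin m)
    {f : (Fin n → ℝ) × (Fin m → ℝ) × (Fin n → Fin m → ℝ) → ℝ} (hf : Differentiable ℝ f)
    (w : (Fin n → ℝ) × (Fin m → ℝ) × (Fin n → Fin m → ℝ)) :
    pdy σ f w = fderiv ℝ f w (0, Pi.single σ 1, 0) := by
  have hc : HasDerivAt (fun t : ℝ => ((w.1, Function.update w.2.1 σ t, w.2.2) :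
      (Fin n → ℝ) × (Fin m → ℝ) × (Fin n → Fin m → ℝ))) (0, Pi.single σ 1, 0) (w.2.1 σ) :=
    (hasDerivAt_const _ w.1).prodMk
      ((hasDerivAt_update w.2.1 σ (w.2.1 σ)).prodMk (hasDerivAt_const _ w.2.2))
  have h2 := (hf (w.1, Function.update w.2.1 σ (w.2.1 σ), w.2.2)).hasFDerivAt.comp_hasDerivAt
    (w.2.1 σ) hc
  have := h2.deriv
  simp only [Function.update_eq_self] at this
  exact this

lemma fmt_pdyj {n m : ℕ} (j : Fin n) (σ : Fin m)
    {f : (Fin n → ℝ) × (Fin m → ℝ) × (Fin n → Fin m → ℝ) → ℝ} (hf : Differentiable ℝ f)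
    (w : (Fin n → ℝ) × (Fin m → ℝ) × (Fin n → Fin m → ℝ)) :
    pdyj j σ f w = fderiv ℝ f w (0, 0, Pi.single j (Pi.single σ 1)) := by
  have h1 : HasDerivAt (fun t : ℝ => Function.update w.2.2 j (Function.update (w.2.2 j) σ t))
      (Pi.single j (Pi.single σ (1 : ℝ))) (w.2.2 j σ) := by
    rw [hasDerivAt_pi]
    intro k
    by_cases hk : k = j
    · subst hk
      simpa using hasDerivAt_update (w.2.2 k) σ (w.2.2 k σ)
    · simpa [hk] using hasDerivAt_const (w.2.2 j σ) (w.2.2 k)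
  have hc : HasDerivAt (fun t : ℝ =>
      ((w.1, w.2.1, Function.update w.2.2 j (Function.update (w.2.2 j) σ t)) :
      (Fin n → ℝ) × (Fin m → ℝ) × (Fin n → Fin m → ℝ)))
      (0, 0, Pi.single j (Pi.single σ 1)) (w.2.2 j σ) :=
    (hasDerivAt_const _ w.1).prodMk ((hasDerivAt_const _ w.2.1).prodMk h1)
  have h2 := (hf (w.1, w.2.1, Function.update w.2.2 j
    (Function.update (w.2.2 j) σ (w.2.2 j σ)))).hasFDerivAt.comp_hasDerivAt (w.2.2 j σ) hc
  have := h2.deriv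
  simp only [Function.update_eq_self] at this
  exact this

lemma fmt_qdx {n m : ℕ} (i : Fin n)
    {g : (Fin n → ℝ) × (Fin m → ℝ) → ℝ} (hg : Differentiable ℝ g)
    (p : (Fin n → ℝ) × (Fin m → ℝ)) :
    qdx i g p = fderiv ℝ g p (Pi.single i 1, 0) := by
  have hc : HasDerivAt (fun t : ℝ => ((Function.update p.1 i t, p.2) :
      (Fin n → ℝ) × (Fin m → ℝ))) (Pi.single i 1, 0) (p.1 i) :=
    (hasDerivAt_update p.1 i (p.1 i)).prodMk (hasDerivAt_const _ p.2)
  have h2 := (hg (Function.update p.1 i (p.1 i), p.2)).hasFDerivAt.comp_hasDerivAt (p.1 i) hc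
  have := h2.deriv
  simp only [Function.update_eq_self] at this
  exact this

lemma fmt_qdy {n m : ℕ} (σ : Fin m)
    {g : (Fin n → ℝ) × (Fin m → ℝ) → ℝ} (hg : Differentiable ℝ g)
    (p : (Fin n → ℝ) × (Fin m → ℝ)) :
    qdy σ g p = fderiv ℝ g p (0, Pi.single σ 1) := by
  have hc : HasDerivAt (fun t : ℝ => ((p.1, Function.update p.2 σ t) :
      (Fin n → ℝ) × (Fin m → ℝ))) (0, Pi.single σ 1) (p.2 σ) :=
    (hasDerivAt_const _ p.1).prodMk (hasDerivAt_update p.2 σ (p.2 σ))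
  have h2 := (hg (p.1, Function.update p.2 σ (p.2 σ))).hasFDerivAt.comp_hasDerivAt (p.2 σ) hc
  have := h2.deriv
  simp only [Function.update_eq_self] at this
  exact this

lemma fmt_split {n m : ℕ}
    (L : (Fin n → ℝ) × (Fin m → ℝ) × (Fin n → Fin m → ℝ) →L[ℝ] ℝ)
    (a : Fin n → ℝ) (b : Fin m → ℝ) (c : Fin n → Fin m → ℝ) :
    L (a, b, c) = L (a, 0, 0) + L (0, b, 0)
      + ∑ j, ∑ σ, c j σ * L (0, 0, Pi.single j (Pi.single σ 1)) := by
  have h0 : ((a, b, c) : (Fin n → ℝ) × (Fin m → ℝ) × (Fin n → Fin m → ℝ))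
      = (a, 0, 0) + (0, b, 0) + ∑ j, ∑ σ, c j σ •
        ((0, 0, Pi.single j (Pi.single σ 1)) :
          (Fin n → ℝ) × (Fin m → ℝ) × (Fin n → Fin m → ℝ)) := by
    refine Prod.ext ?_ (Prod.ext ?_ ?_)
    · simp [Prod.fst_sum]
    · simp [Prod.fst_sum, Prod.snd_sum]
    · funext k ρ
      simp [Prod.snd_sum, Finset.sum_apply, Pi.single_apply, Finset.sum_ite_eq]
  rw [h0]
  simp only [map_add, map_sum, map_smul, smul_eq_mul]

lemma fmt_hasFDerivAt_sec {n m : ℕ}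
    {Z : Fin n → Fin m → (Fin n → ℝ) × (Fin m → ℝ) → ℝ}
    (hZ : ∀ i σ, Differentiable ℝ (Z i σ)) (p : (Fin n → ℝ) × (Fin m → ℝ)) :
    HasFDerivAt (sec Z) ((ContinuousLinearMap.fst ℝ _ _).prod
      ((ContinuousLinearMap.snd ℝ _ _).prod
        (ContinuousLinearMap.pi fun j => ContinuousLinearMap.pi fun σ => fderiv ℝ (Z j σ) p))) p := by
  unfold sec
  refine hasFDerivAt_fst.prodMk (hasFDerivAt_snd.prodMk ?_)
  rw [hasFDerivAt_pi]
  intro j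
  rw [hasFDerivAt_pi]
  intro σ
  exact (hZ j σ p).hasFDerivAt

lemma fmt_fderiv_sec {n m : ℕ}
    {Z : Fin n → Fin m → (Fin n → ℝ) × (Fin m → ℝ) → ℝ}
    (hZ : ∀ i σ, Differentiable ℝ (Z i σ))
    {f : (Fin n → ℝ) × (Fin m → ℝ) × (Fin n → Fin m → ℝ) → ℝ} (hf : Differentiable ℝ f)
    (p u : (Fin n → ℝ) × (Fin m → ℝ)) :
    fderiv ℝ (fun q => f (sec Z q)) p u =
      fderiv ℝ f (sec Z p) (u.1, u.2, fun j σ => fderiv ℝ (Z j σ) p u) := by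
  have h := (hf (sec Z p)).hasFDerivAt.comp p (fmt_hasFDerivAt_sec hZ p)
  have h2 := h.fderiv
  have h3 : (fun q => f (sec Z q)) = f ∘ sec Z := rfl
  rw [h3, h2]
  rfl

lemma fmt_diff_sec {n m : ℕ}
    {Z : Fin n → Fin m → (Fin n → ℝ) × (Fin m → ℝ) → ℝ}
    (hZ : ∀ i σ, Differentiable ℝ (Z i σ))
    {f : (Fin n → ℝ) × (Fin m → ℝ) × (Fin n → Fin m → ℝ) → ℝ} (hf : Differentiable ℝ f) :
    Differentiable ℝ (fun q => f (sec Z q)) := fun p =>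
  ((hf (sec Z p)).hasFDerivAt.comp p (fmt_hasFDerivAt_sec hZ p)).differentiableAt

lemma fmt_qdy_sec {n m : ℕ}
    {Z : Fin n → Fin m → (Fin n → ℝ) × (Fin m → ℝ) → ℝ}
    (hZ : ∀ i σ, Differentiable ℝ (Z i σ))
    {f : (Fin n → ℝ) × (Fin m → ℝ) × (Fin n → Fin m → ℝ) → ℝ} (hf : Differentiable ℝ f)
    (ν : Fin m) (p : (Fin n → ℝ) × (Fin m → ℝ)) :
    qdy ν (fun q => f (sec Z q)) p = pdy ν f (sec Z p)
      + ∑ j, ∑ ρ, qdy ν (Z j ρ) p * pdyj j ρ f (sec Z p) := by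
  rw [fmt_qdy ν (fmt_diff_sec hZ hf), fmt_fderiv_sec hZ hf, fmt_split, fmt_pdy ν hf]
  simp only [fmt_qdy ν (hZ _ _), fmt_pdyj _ _ hf]
  have : ((0, 0, 0) : (Fin n → ℝ) × (Fin m → ℝ) × (Fin n → Fin m → ℝ)) = 0 := rfl
  rw [this, map_zero, zero_add]

lemma fmt_qdx_sec {n m : ℕ}
    {Z : Fin n → Fin m → (Fin n → ℝ) × (Fin m → ℝ) → ℝ}
    (hZ : ∀ i σ, Differentiable ℝ (Z i σ))
    {f : (Fin n → ℝ) × (Fin m → ℝ) × (Fin n → Fin m → ℝ) → ℝ} (hf : Differentiable ℝ f)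
    (i : Fin n) (p : (Fin n → ℝ) × (Fin m → ℝ)) :
    qdx i (fun q => f (sec Z q)) p = pdx i f (sec Z p)
      + ∑ j, ∑ ρ, qdx i (Z j ρ) p * pdyj j ρ f (sec Z p) := by
  rw [fmt_qdx i (fmt_diff_sec hZ hf), fmt_fderiv_sec hZ hf, fmt_split, fmt_pdx i hf]
  simp only [fmt_qdx i (hZ _ _), fmt_pdyj _ _ hf]
  have : ((0, 0, 0) : (Fin n → ℝ) × (Fin m → ℝ) × (Fin n → Fin m → ℝ)) = 0 := rfl
  rw [this, map_zero, add_zero]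

/-- `Z_i (f ∘ s) = (Γ_i f) ∘ s`. -/
lemma fmt_Zop_sec {n m : ℕ}
    {F : Fin n → Fin n → Fin m →
      (Fin n → ℝ) × (Fin m → ℝ) × (Fin n → Fin m → ℝ) → ℝ}
    {Z : Fin n → Fin m → (Fin n → ℝ) × (Fin m → ℝ) → ℝ}
    (hZ : ∀ i σ, Differentiable ℝ (Z i σ))
    (hemb : ∀ i j σ p, Zop Z i (Z j σ) p = F i j σ (sec Z p))
    {f : (Fin n → ℝ) × (Fin m → ℝ) × (Fin n → Fin m → ℝ) → ℝ} (hf : Differentiable ℝ f)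
    (i : Fin n) (p : (Fin n → ℝ) × (Fin m → ℝ)) :
    Zop Z i (fun q => f (sec Z q)) p = Gammaop F i f (sec Z p) := by
  unfold Gammaop
  simp only [← hemb]
  unfold Zop
  simp only [fmt_qdx_sec hZ hf, fmt_qdy_sec hZ hf, mul_add, sum_add_distrib, add_mul]
  have h1 : ∑ x, Z i x p * ∑ j, ∑ ρ, qdy x (Z j ρ) p * pdyj j ρ f (sec Z p)
      = ∑ j, ∑ ρ, (∑ x, Z i x p * qdy x (Z j ρ) p) * pdyj j ρ f (sec Z p) := by
    simp only [mul_sum, sum_mul]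
    rw [sum_comm]
    refine sum_congr rfl fun j _ => ?_
    rw [sum_comm]
    refine sum_congr rfl fun ρ _ => sum_congr rfl fun x _ => ?_
    ring
  rw [h1]
  simp only [sec]
  ring

lemma fmt_swap {n m : ℕ} {g : (Fin n → ℝ) × (Fin m → ℝ) → ℝ} (hg : ContDiff ℝ (⊤ : ℕ∞) g)
    (p u w : (Fin n → ℝ) × (Fin m → ℝ)) :
    fderiv ℝ (fun q => fderiv ℝ g q u) p w = fderiv ℝ (fun q => fderiv ℝ g q w) p u := by
  have hd : Differentiable ℝ (fderiv ℝ g) :=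
    (hg.fderiv_right (m := 1) (by norm_cast)).differentiable (by norm_num)
  have key : ∀ u w, fderiv ℝ (fun q => fderiv ℝ g q u) p w = fderiv ℝ (fderiv ℝ g) p w u := by
    intro u w
    rw [fderiv_clm_apply (hd p) (by fun_prop)]
    simp
  rw [key, key]
  exact (hg.contDiffAt.isSymmSndFDerivAt (by simp; exact WithTop.coe_le_coe.2 (le_top : (2 : ℕ∞) ≤ ⊤))) w u

lemma fmt_contDiff_dir {n m : ℕ} {g : (Fin n → ℝ) × (Fin m → ℝ) → ℝ}
    (hg : ContDiff ℝ (⊤ : ℕ∞) g) (u : (Fin n → ℝ) × (Fin m → ℝ)) :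
    Differentiable ℝ (fun q => fderiv ℝ g q u) := by
  have hd : Differentiable ℝ (fderiv ℝ g) :=
    (hg.fderiv_right (m := 1) (by norm_cast)).differentiable (by norm_num)
  fun_prop

/-- The `y^ν`-derivative of the embedding condition. -/
lemma fmt_Zop_qdy {n m : ℕ}
    {F : Fin n → Fin n → Fin m →
      (Fin n → ℝ) × (Fin m → ℝ) × (Fin n → Fin m → ℝ) → ℝ}
    (hF : ∀ i j σ, Differentiable ℝ (F i j σ))
    {Z : Fin n → Fin m → (Fin n → ℝ) × (Fin m → ℝ) → ℝ}
    (hZ : ∀ i σ, ContDiff ℝ (⊤ : ℕ∞) (Z i σ))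
    (hemb : ∀ i j σ p, Zop Z i (Z j σ) p = F i j σ (sec Z p))
    (i k : Fin n) (σ ν : Fin m) (p : (Fin n → ℝ) × (Fin m → ℝ)) :
    Zop Z i (qdy ν (Z k σ)) p = pdy ν (F i k σ) (sec Z p)
      + ∑ j, ∑ ρ, qdy ν (Z j ρ) p * pdyj j ρ (F i k σ) (sec Z p)
      - ∑ ρ, qdy ν (Z i ρ) p * qdy ρ (Z k σ) p := by
  have hZd : ∀ i σ, Differentiable ℝ (Z i σ) := fun i σ => (hZ i σ).differentiable (by simp)
  rw [← fmt_qdy_sec hZd (hF i k σ)]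
  have e : (fun q => F i k σ (sec Z q)) = fun q => fderiv ℝ (Z k σ) q (Pi.single i 1, 0)
      + ∑ ρ, Z i ρ q * fderiv ℝ (Z k σ) q (0, Pi.single ρ 1) := by
    funext q
    rw [← hemb]
    unfold Zop
    simp only [fmt_qdx _ (hZd _ _), fmt_qdy _ (hZd _ _)]
  have hd := fun u => fmt_contDiff_dir (hZ k σ) u
  rw [fmt_qdy ν (fmt_diff_sec hZd (hF i k σ)), e]
  have e2 : qdy ν (Z k σ) = fun q => fderiv ℝ (Z k σ) q (0, Pi.single ν 1) :=
    funext fun q => fmt_qdy ν (hZd k σ) q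
  rw [e2]
  unfold Zop
  simp only [fmt_qdx _ (hd _), fmt_qdy _ (hd _), fmt_qdy _ (hZd _ _)]
  rw [fderiv_fun_add (hd _ p) (by fun_prop), fderiv_fun_sum (by intro ρ _; fun_prop)]
  simp only [add_apply, _root_.sum_apply]
  rw [add_sub_assoc, ← sum_sub_distrib, fmt_swap (hZ k σ) p (0, Pi.single ν 1)]
  congr 1
  refine sum_congr rfl fun ρ _ => ?_
  rw [fderiv_fun_mul (hZd i ρ p) (hd _ p), fmt_swap (hZ k σ) p (0, Pi.single ν 1)]
  simp
  ring

lemma fmt_diff_pdyj {n m : ℕ}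
    {f : (Fin n → ℝ) × (Fin m → ℝ) × (Fin n → Fin m → ℝ) → ℝ} (hf : ContDiff ℝ (⊤ : ℕ∞) f)
    (j : Fin n) (σ : Fin m) : Differentiable ℝ (pdyj j σ f) := by
  have hd : Differentiable ℝ (fderiv ℝ f) :=
    (hf.fderiv_right (m := 1) (by norm_cast)).differentiable (by norm_num)
  have e : pdyj j σ f = fun w => fderiv ℝ f w (0, 0, Pi.single j (Pi.single σ 1)) :=
    funext fun w => fmt_pdyj j σ (hf.differentiable (by simp)) w
  rw [e]
  fun_prop

lemma fmt_diff_Hfun {n m : ℕ} [NeZero n]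
    {F : Fin n → Fin n → Fin m →
      (Fin n → ℝ) × (Fin m → ℝ) × (Fin n → Fin m → ℝ) → ℝ}
    (hF : ∀ i j σ, ContDiff ℝ (⊤ : ℕ∞) (F i j σ))
    {v : Fin n → (Fin n → ℝ) → ℝ} (hv : ∀ i, Differentiable ℝ (v i))
    (σ : Fin m) (k : Fin n) (ν : Fin m) : Differentiable ℝ (Hfun F v σ k ν) := by
  have h1 := fun i j σ' τ => fmt_diff_pdyj (hF i j σ') 0 τ
  unfold Hfun
  by_cases hk : k = 0
  · simp only [hk, if_true]
    fun_prop
  · simp only [hk, if_false]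
    fun_prop

/-- `v^k H_{ρk}^σ = ½ v^i v^k ∂F_{ik}^σ/∂y_1^ρ`. -/
lemma fmt_trace {n m : ℕ}
    {F : Fin (n + 2) → Fin (n + 2) → Fin m →
      (Fin (n + 2) → ℝ) × (Fin m → ℝ) × (Fin (n + 2) → Fin m → ℝ) → ℝ}
    (hFsymm : ∀ i j σ, F i j σ = F j i σ)
    {v : Fin (n + 2) → (Fin (n + 2) → ℝ) → ℝ} (hv1 : ∀ x, v 0 x = 1)
    (ρ σ : Fin m) (w : (Fin (n + 2) → ℝ) × (Fin m → ℝ) × (Fin (n + 2) → Fin m → ℝ)) :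
    2 * ∑ k, v k w.1 * Hfun F v ρ k σ w
      = ∑ i, ∑ k, v i w.1 * v k w.1 * pdyj 0 ρ (F i k σ) w := by
  have hs : ∀ g : Fin (n + 2) → ℝ, ∑ k, g k = g 0 + ∑ k ∈ univ.erase 0, g k := fun g =>
    (add_sum_erase univ g (mem_univ 0)).symm
  have e1 : ∑ k ∈ univ.erase (0 : Fin (n + 2)), v k w.1 * Hfun F v ρ k σ w
      = ∑ k ∈ univ.erase (0 : Fin (n + 2)), v k w.1 * pdyj 0 ρ (F 0 k σ) w
        + ∑ p ∈ univ.erase (0 : Fin (n + 2)), ∑ q ∈ univ.erase (0 : Fin (n + 2)),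
          v p w.1 * v q w.1 * pdyj 0 ρ (F p q σ) w := by
    rw [← sum_add_distrib]
    refine sum_congr rfl fun k hk => ?_
    have hk0 : k ≠ 0 := (mem_erase.mp hk).1
    simp only [Hfun, hk0, if_false]
    rw [hs, hv1, mul_add, mul_sum, hFsymm k 0]
    congr 1
    · ring
    · refine sum_congr rfl fun q _ => ?_
      ring
  have e2 : ∑ i, ∑ k, v i w.1 * v k w.1 * pdyj 0 ρ (F i k σ) w
      = pdyj 0 ρ (F 0 0 σ) w
        + 2 * ∑ k ∈ univ.erase (0 : Fin (n + 2)), v k w.1 * pdyj 0 ρ (F 0 k σ) w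
        + ∑ p ∈ univ.erase (0 : Fin (n + 2)), ∑ q ∈ univ.erase (0 : Fin (n + 2)),
          v p w.1 * v q w.1 * pdyj 0 ρ (F p q σ) w := by
    have : ∀ i, ∑ k, v i w.1 * v k w.1 * pdyj 0 ρ (F i k σ) w
        = v i w.1 * pdyj 0 ρ (F 0 i σ) w
          + ∑ k ∈ univ.erase (0 : Fin (n + 2)), v i w.1 * v k w.1 * pdyj 0 ρ (F i k σ) w := by
      intro i
      rw [hs, hv1, mul_one, hFsymm i 0]
    simp only [this]
    rw [hs]
    simp only [sum_add_distrib, hv1, one_mul]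
    ring
  rw [hs, e1, e2]
  simp only [Hfun, if_true, hv1]
  ring

/-- The purely algebraic part of the computation. -/
lemma fmt_algebra {n m : ℕ} (V : Fin (n + 2) → ℝ) (hV : V 0 = 1)
    (N G : Fin (n + 2) → Fin (n + 2) → ℝ) (D : Fin (n + 2) → Fin (n + 2) → Fin (n + 2) → Fin m → ℝ)
    (a b h g : Fin (n + 2) → Fin m → ℝ)
    (htr : ∀ ρ, 2 * ∑ k, V k * h k ρ = ∑ i, ∑ k, V i * V k * D i k 0 ρ) :
    (∑ i, ∑ k, V i * V k *
        ((N i k + ∑ j, ∑ ρ, a j ρ * D i k j ρ - ∑ ρ, a i ρ * b k ρ) - G i k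
          + ∑ ρ, (b k ρ - h k ρ) * a i ρ - ∑ ρ, (a k ρ - g k ρ) * b i ρ))
    + (∑ i, ∑ k, ∑ ρ, V i * V k *
        (b i ρ * a k ρ - h i ρ * a k ρ - g k ρ * b i ρ + h i ρ * g k ρ))
    + (∑ i, V i * ∑ k, V k * (G i k - (N i k + ∑ j, ∑ ρ, g j ρ * D i k j ρ)
        + ∑ ρ, g i ρ * h k ρ))
    + (∑ i, ∑ k, ∑ j ∈ univ.erase (0 : Fin (n + 2)), ∑ ρ,
        V i * V k * (V j * D i k 0 ρ - D i k j ρ) * (a j ρ - g j ρ)) = 0 := by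
  have hs : ∀ g : Fin (n + 2) → ℝ, ∑ k, g k = g 0 + ∑ k ∈ univ.erase 0, g k := fun g =>
    (add_sum_erase univ g (mem_univ 0)).symm
  -- combine everything termwise
  have step : ∀ i k, V i * V k *
        ((N i k + ∑ j, ∑ ρ, a j ρ * D i k j ρ - ∑ ρ, a i ρ * b k ρ) - G i k
          + ∑ ρ, (b k ρ - h k ρ) * a i ρ - ∑ ρ, (a k ρ - g k ρ) * b i ρ)
      + ∑ ρ, V i * V k * (b i ρ * a k ρ - h i ρ * a k ρ - g k ρ * b i ρ + h i ρ * g k ρ)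
      + V i * (V k * (G i k - (N i k + ∑ j, ∑ ρ, g j ρ * D i k j ρ) + ∑ ρ, g i ρ * h k ρ))
      + ∑ j ∈ univ.erase (0 : Fin (n + 2)), ∑ ρ,
        V i * V k * (V j * D i k 0 ρ - D i k j ρ) * (a j ρ - g j ρ)
      = ∑ ρ, (V i * V k * D i k 0 ρ) * ∑ j, V j * (a j ρ - g j ρ)
        - ∑ ρ, (V k * h k ρ) * (V i * (a i ρ - g i ρ))
        - ∑ ρ, (V i * h i ρ) * (V k * (a k ρ - g k ρ)) := by
    intro i k
    have q1 : ∑ j ∈ univ.erase (0 : Fin (n + 2)), ∑ ρ,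
        V i * V k * (V j * D i k 0 ρ - D i k j ρ) * (a j ρ - g j ρ)
        = ∑ j, ∑ ρ, V i * V k * (V j * D i k 0 ρ - D i k j ρ) * (a j ρ - g j ρ) := by
      rw [hs (fun j => ∑ ρ, V i * V k * (V j * D i k 0 ρ - D i k j ρ) * (a j ρ - g j ρ))]
      simp [hV]
    have q2 : ∑ j, ∑ ρ, V i * V k * (V j * D i k 0 ρ - D i k j ρ) * (a j ρ - g j ρ)
        = ∑ ρ, (V i * V k * D i k 0 ρ) * (∑ j, V j * (a j ρ - g j ρ))
          - V i * V k * ∑ j, ∑ ρ, a j ρ * D i k j ρ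
          + V i * V k * ∑ j, ∑ ρ, g j ρ * D i k j ρ := by
      simp only [mul_sum]
      rw [sum_comm (f := fun ρ j => V i * V k * D i k 0 ρ * (V j * (a j ρ - g j ρ)))]
      rw [← sum_sub_distrib, ← sum_add_distrib]
      refine sum_congr rfl fun j _ => ?_
      rw [← sum_sub_distrib, ← sum_add_distrib]
      refine sum_congr rfl fun ρ _ => ?_
      ring
    have q3 : V i * V k * (- (∑ ρ, a i ρ * b k ρ) + ∑ ρ, (b k ρ - h k ρ) * a i ρ
          - ∑ ρ, (a k ρ - g k ρ) * b i ρ)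
        + ∑ ρ, V i * V k * (b i ρ * a k ρ - h i ρ * a k ρ - g k ρ * b i ρ + h i ρ * g k ρ)
        + V i * V k * ∑ ρ, g i ρ * h k ρ
        = - ∑ ρ, (V k * h k ρ) * (V i * (a i ρ - g i ρ))
        - ∑ ρ, (V i * h i ρ) * (V k * (a k ρ - g k ρ)) := by
      simp only [mul_add, mul_sub, mul_neg, mul_sum, ← sum_neg_distrib, ← sum_sub_distrib,
        ← sum_add_distrib]
      refine sum_congr rfl fun ρ _ => ?_
      ring
    rw [q1, q2]
    linear_combination q3
  have e1 : ∑ i, ∑ k, ∑ ρ, (V k * h k ρ) * (V i * (a i ρ - g i ρ))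
      = ∑ ρ, (∑ k, V k * h k ρ) * ∑ j, V j * (a j ρ - g j ρ) := by
    simp only [sum_mul_sum]
    rw [sum_comm]
    rw [sum_comm (s := (univ : Finset (Fin m)))]
    refine sum_congr rfl fun k _ => ?_
    rw [sum_comm]
  have e2 : ∑ i, ∑ k, ∑ ρ, (V i * h i ρ) * (V k * (a k ρ - g k ρ))
      = ∑ ρ, (∑ k, V k * h k ρ) * ∑ j, V j * (a j ρ - g j ρ) := by
    rw [← e1, sum_comm]
  have e3 : ∑ i, ∑ k, ∑ ρ, (V i * V k * D i k 0 ρ) * ∑ j, V j * (a j ρ - g j ρ)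
      = ∑ ρ, (∑ i, ∑ k, V i * V k * D i k 0 ρ) * ∑ j, V j * (a j ρ - g j ρ) := by
    simp only [sum_mul]
    rw [sum_comm (s := (univ : Finset (Fin m)))]
    refine sum_congr rfl fun i _ => ?_
    rw [sum_comm]
  simp only [mul_sum (s := univ) (f := fun k => V k * (G _ k - _ + _))]
  simp only [← sum_add_distrib]
  simp only [step, sum_sub_distrib]
  rw [e1, e2, e3, ← sum_sub_distrib, ← sum_sub_distrib]
  refine sum_eq_zero fun ρ _ => ?_
  rw [← htr]
  ring

end helpers

/-- **First Main Theorem (Theorem 3.2.5) in adapted coordinates.** The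
directional shape operator satisfies
`L_{Z_v} A_Z = −(A_Z)² − i_{Z_v}(Z^φ Φ_+ + Z^φ r_+)`; in components, the sum
`T1 + T2 + T3 + T4 + T5` of the component expressions of `L_{Z_v}A_Z`,
`(A_Z)²`, the pulled-back partial Jacobi endomorphism term and the pulled-back
curvature `r_+` term vanishes identically. -/
theorem first_main_theorem
    (n m : ℕ)
    (F : Fin (n + 2) → Fin (n + 2) → Fin (m + 1) →
      (Fin (n + 2) → ℝ) × (Fin (m + 1) → ℝ) × (Fin (n + 2) → Fin (m + 1) → ℝ) → ℝ)
    (hF : ∀ i j σ, ContDiff ℝ (⊤ : ℕ∞) (F i j σ))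
    (hFsymm : ∀ i j σ, F i j σ = F j i σ)
    (Z : Fin (n + 2) → Fin (m + 1) → (Fin (n + 2) → ℝ) × (Fin (m + 1) → ℝ) → ℝ)
    (hZ : ∀ i σ, ContDiff ℝ (⊤ : ℕ∞) (Z i σ))
    (hemb : ∀ i j σ p, Zop Z i (Z j σ) p = F i j σ (sec Z p))
    (v : Fin (n + 2) → (Fin (n + 2) → ℝ) → ℝ)
    (hv : ∀ i, ContDiff ℝ (⊤ : ℕ∞) (v i))
    (hv1 : ∀ x, v 0 x = 1) :
    ∀ (σ ν : Fin (m + 1)) (p : (Fin (n + 2) → ℝ) × (Fin (m + 1) → ℝ)),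
      -- T1 : components of L_{Z_v} A_Z (the ∂v-part)
      (∑ i, ∑ k, v i p.1 * xd i (v k) p.1 *
          (qdy ν (Z k σ) p - Hfun F v ν k σ (sec Z p)))
      -- T2 : components of L_{Z_v} A_Z (the v^i v^k part)
      + (∑ i, ∑ k, v i p.1 * v k p.1 *
          (Zop Z i (qdy ν (Z k σ)) p
            - Zop Z i (fun q => Hfun F v ν k σ (sec Z q)) p
            + ∑ ρ, (qdy ρ (Z k σ) p - Hfun F v ρ k σ (sec Z p)) * qdy ν (Z i ρ) p
            - ∑ ρ, (qdy ν (Z k ρ) p - Hfun F v ν k ρ (sec Z p)) * qdy ρ (Z i σ) p))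
      -- T3 : components of (A_Z)²
      + (∑ i, ∑ k, ∑ ρ, v i p.1 * v k p.1 *
          (qdy ρ (Z i σ) p * qdy ν (Z k ρ) p
            - Hfun F v ρ i σ (sec Z p) * qdy ν (Z k ρ) p
            - Hfun F v ν k ρ (sec Z p) * qdy ρ (Z i σ) p
            + Hfun F v ρ i σ (sec Z p) * Hfun F v ν k ρ (sec Z p)))
      -- T4 : components of i_{Z_v} Z^φ Φ_+
      + (∑ i, v i p.1 * Phi F v i ν σ (sec Z p))
      -- T5 : components of i_{Z_v} Z^φ r_+
      + ((∑ i, ∑ k, ∑ p' ∈ Finset.univ.erase (0 : Fin (n + 2)), ∑ ρ,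
            v i p.1 * v k p.1 *
              (v p' p.1 * pdyj 0 ρ (F i k σ) (sec Z p)
                - pdyj p' ρ (F i k σ) (sec Z p)) *
              (qdy ν (Z p' ρ) p - Hfun F v ν p' ρ (sec Z p)))
          - ∑ i, ∑ p' ∈ Finset.univ.erase (0 : Fin (n + 2)),
              v i p.1 * xd i (v p') p.1 *
                (qdy ν (Z p' σ) p - Hfun F v ν p' σ (sec Z p)))
      = 0 := by
  intro σ ν p
  have hFd : ∀ i j σ, Differentiable ℝ (F i j σ) := fun i j σ => (hF i j σ).differentiable (by simp)
  have hZd : ∀ i σ, Differentiable ℝ (Z i σ) := fun i σ => (hZ i σ).differentiable (by simp)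
  have hH := fun ν k σ => fmt_diff_Hfun hF (fun i => (hv i).differentiable (by simp)) ν k σ
  have hxd0 : ∀ i, xd i (v 0) p.1 = 0 := by
    intro i
    simp [xd, hv1]
  have hT1 : ∑ i, ∑ k, v i p.1 * xd i (v k) p.1 *
          (qdy ν (Z k σ) p - Hfun F v ν k σ (sec Z p))
      = ∑ i, ∑ p' ∈ Finset.univ.erase (0 : Fin (n + 2)),
              v i p.1 * xd i (v p') p.1 *
                (qdy ν (Z p' σ) p - Hfun F v ν p' σ (sec Z p)) := by
    refine Finset.sum_congr rfl fun i _ => ?_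
    rw [← Finset.add_sum_erase Finset.univ _ (Finset.mem_univ (0 : Fin (n + 2))), hxd0]
    simp
  have alg := fmt_algebra (fun i => v i p.1) (hv1 p.1)
    (fun i k => pdy ν (F i k σ) (sec Z p))
    (fun i k => Gammaop F i (Hfun F v ν k σ) (sec Z p))
    (fun i k j ρ => pdyj j ρ (F i k σ) (sec Z p))
    (fun k ρ => qdy ν (Z k ρ) p) (fun k ρ => qdy ρ (Z k σ) p)
    (fun k ρ => Hfun F v ρ k σ (sec Z p)) (fun k ρ => Hfun F v ν k ρ (sec Z p))
    (fun ρ => fmt_trace hFsymm hv1 ρ σ (sec Z p))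
  rw [hT1]
  simp only [fmt_Zop_qdy hFd hZ hemb, fmt_Zop_sec hZd hemb (hH _ _ _), Phi, Hop]
  have hs1 : (sec Z p).1 = p.1 := rfl
  rw [hs1]
  linear_combination alg
end

section
/- (Third Main Theorem, Theorem 3.4.4, in adapted coordinates.) The total shape operator satisfies [[Z, Â_Z]] = −A² − Z ∧ Φ; in components: defining A_{ρk}^ν = ∂Z_k^ν/∂y^ρ − H̄_{ρk}^ν and Φ̄_{iρk}^ν = (Γ_i(H_{ρk}^ν) − H_ρ(F_{ik}^ν)) ∘ s + Σ_σ H̄_{ρi}^σ H̄_{σk}^ν, for all indices i, k, ρ, ν the expression E(i,k) = Z_i(A_{ρk}^ν) + Σ_σ A_{σk}^ν (∂Z_i^σ/∂y^ρ) − Σ_σ A_{ρk}^σ (∂Z_i^ν/∂y^σ) + Φ̄_{iρk}^ν − Σ_σ A_{ρi}^σ A_{σk}^ν is symmetric under interchange of i and k, i.e. E(i,k) = E(k,i) at every point of ℝⁿ × ℝᵐ. -/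
open scoped BigOperators

/-- The components `A_{ρk}^ν = ∂Z_k^ν/∂y^ρ − H̄_{ρk}^ν` of the total shape
operator relative to the basis `dx^k ∧ ω̄^ρ ⊗ ∂/∂y^ν`. -/
noncomputable def Acomp {n m : ℕ} [NeZero n]
    (F : Fin n → Fin n → Fin m →
      (Fin n → ℝ) × (Fin m → ℝ) × (Fin n → Fin m → ℝ) → ℝ)
    (v : Fin n → (Fin n → ℝ) → ℝ)
    (Z : Fin n → Fin m → (Fin n → ℝ) × (Fin m → ℝ) → ℝ)
    (ρ : Fin m) (k : Fin n) (ν : Fin m)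
    (p : (Fin n → ℝ) × (Fin m → ℝ)) : ℝ :=
  qdy ρ (Z k ν) p - Hfun F v ρ k ν (sec Z p)

/-- The pulled-back Jacobi endomorphism components
`Φ̄_{iρk}^ν = (Γ_i(H_{ρk}^ν) − H_ρ(F_{ik}^ν)) ∘ s + Σ_σ H̄_{ρi}^σ H̄_{σk}^ν`. -/
noncomputable def Phibar {n m : ℕ} [NeZero n]
    (F : Fin n → Fin n → Fin m →
      (Fin n → ℝ) × (Fin m → ℝ) × (Fin n → Fin m → ℝ) → ℝ)
    (v : Fin n → (Fin n → ℝ) → ℝ)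
    (Z : Fin n → Fin m → (Fin n → ℝ) × (Fin m → ℝ) → ℝ)
    (i : Fin n) (ρ : Fin m) (k : Fin n) (ν : Fin m)
    (p : (Fin n → ℝ) × (Fin m → ℝ)) : ℝ :=
  Gammaop F i (Hfun F v ρ k ν) (sec Z p) - Hop (Hfun F v) ρ (F i k ν) (sec Z p)
    + ∑ σ, Hfun F v ρ i σ (sec Z p) * Hfun F v σ k ν (sec Z p)

/-- The coefficient `E(i,k)` of `dx^i ∧ dx^k ∧ ω̄^ρ ⊗ ∂/∂y^ν` in
`[[Z, Â_Z]] + A² + Z ∧ Φ`. -/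
noncomputable def Ecomp {n m : ℕ} [NeZero n]
    (F : Fin n → Fin n → Fin m →
      (Fin n → ℝ) × (Fin m → ℝ) × (Fin n → Fin m → ℝ) → ℝ)
    (v : Fin n → (Fin n → ℝ) → ℝ)
    (Z : Fin n → Fin m → (Fin n → ℝ) × (Fin m → ℝ) → ℝ)
    (i k : Fin n) (ρ ν : Fin m)
    (p : (Fin n → ℝ) × (Fin m → ℝ)) : ℝ :=
  Zop Z i (Acomp F v Z ρ k ν) p
    + ∑ σ, Acomp F v Z σ k ν p * qdy ρ (Z i σ) p
    - ∑ σ, Acomp F v Z ρ k σ p * qdy σ (Z i ν) p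
    + Phibar F v Z i ρ k ν p
    - ∑ σ, Acomp F v Z ρ i σ p * Acomp F v Z σ k ν p

section Helpers

variable {n m : ℕ}

theorem qdx_eq (i : Fin n) (g : (Fin n → ℝ) × (Fin m → ℝ) → ℝ)
    (hg : Differentiable ℝ g) (p) : qdx i g p = fderiv ℝ g p (Pi.single i 1, 0) := by
  unfold qdx
  have h1 : HasDerivAt (fun t => ((Function.update p.1 i t, p.2) : (Fin n → ℝ) × (Fin m → ℝ)))
      (Pi.single i 1, 0) (p.1 i) :=
    (hasDerivAt_update p.1 i (p.1 i)).prodMk (hasDerivAt_const _ _)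
  have h2 : HasFDerivAt g (fderiv ℝ g p) (Function.update p.1 i (p.1 i), p.2) := by
    simpa using (hg p).hasFDerivAt
  exact (h2.comp_hasDerivAt (p.1 i) h1).deriv

theorem qdy_eq (i : Fin m) (g : (Fin n → ℝ) × (Fin m → ℝ) → ℝ)
    (hg : Differentiable ℝ g) (p) : qdy i g p = fderiv ℝ g p (0, Pi.single i 1) := by
  unfold qdy
  have h1 : HasDerivAt (fun t => ((p.1, Function.update p.2 i t) : (Fin n → ℝ) × (Fin m → ℝ)))
      (0, Pi.single i 1) (p.2 i) :=
    (hasDerivAt_const _ _).prodMk (hasDerivAt_update p.2 i (p.2 i))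
  have h2 : HasFDerivAt g (fderiv ℝ g p) (p.1, Function.update p.2 i (p.2 i)) := by
    simpa using (hg p).hasFDerivAt
  exact (h2.comp_hasDerivAt (p.2 i) h1).deriv

theorem pdx_eq (i : Fin n) (f : (Fin n → ℝ) × (Fin m → ℝ) × (Fin n → Fin m → ℝ) → ℝ)
    (hf : Differentiable ℝ f) (w) : pdx i f w = fderiv ℝ f w (Pi.single i 1, 0, 0) := by
  unfold pdx
  have h1 : HasDerivAt (fun t => ((Function.update w.1 i t, w.2.1, w.2.2) :
      (Fin n → ℝ) × (Fin m → ℝ) × (Fin n → Fin m → ℝ)))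
      (Pi.single i 1, 0, 0) (w.1 i) :=
    (hasDerivAt_update w.1 i (w.1 i)).prodMk
      ((hasDerivAt_const _ _).prodMk (hasDerivAt_const _ _))
  have h2 : HasFDerivAt f (fderiv ℝ f w) (Function.update w.1 i (w.1 i), w.2.1, w.2.2) := by
    simpa using (hf w).hasFDerivAt
  exact (h2.comp_hasDerivAt (w.1 i) h1).deriv

theorem pdy_eq (i : Fin m) (f : (Fin n → ℝ) × (Fin m → ℝ) × (Fin n → Fin m → ℝ) → ℝ)
    (hf : Differentiable ℝ f) (w) : pdy i f w = fderiv ℝ f w (0, Pi.single i 1, 0) := by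
  unfold pdy
  have h1 : HasDerivAt (fun t => ((w.1, Function.update w.2.1 i t, w.2.2) :
      (Fin n → ℝ) × (Fin m → ℝ) × (Fin n → Fin m → ℝ)))
      (0, Pi.single i 1, 0) (w.2.1 i) :=
    (hasDerivAt_const _ _).prodMk
      ((hasDerivAt_update w.2.1 i (w.2.1 i)).prodMk (hasDerivAt_const _ _))
  have h2 : HasFDerivAt f (fderiv ℝ f w) (w.1, Function.update w.2.1 i (w.2.1 i), w.2.2) := by
    simpa using (hf w).hasFDerivAt
  exact (h2.comp_hasDerivAt (w.2.1 i) h1).deriv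

theorem pdyj_eq (j : Fin n) (i : Fin m)
    (f : (Fin n → ℝ) × (Fin m → ℝ) × (Fin n → Fin m → ℝ) → ℝ)
    (hf : Differentiable ℝ f) (w) :
    pdyj j i f w = fderiv ℝ f w (0, 0, Pi.single j (Pi.single i 1)) := by
  unfold pdyj
  have h0 : HasDerivAt (fun t => Function.update w.2.2 j (Function.update (w.2.2 j) i t))
      (Pi.single j (Pi.single i 1)) (w.2.2 j i) := by
    rw [hasDerivAt_pi]
    intro k
    by_cases hk : k = j
    · subst hk
      simpa using hasDerivAt_update (w.2.2 k) i (w.2.2 k i)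
    · simpa [hk] using hasDerivAt_const (w.2.2 j i) (w.2.2 k)
  have h1 : HasDerivAt (fun t => ((w.1, w.2.1,
      Function.update w.2.2 j (Function.update (w.2.2 j) i t)) :
      (Fin n → ℝ) × (Fin m → ℝ) × (Fin n → Fin m → ℝ)))
      (0, 0, Pi.single j (Pi.single i 1)) (w.2.2 j i) :=
    (hasDerivAt_const _ _).prodMk ((hasDerivAt_const _ _).prodMk h0)
  have h2 : HasFDerivAt f (fderiv ℝ f w) (w.1, w.2.1,
      Function.update w.2.2 j (Function.update (w.2.2 j) i (w.2.2 j i))) := by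
    simpa using (hf w).hasFDerivAt
  exact (h2.comp_hasDerivAt (w.2.2 j i) h1).deriv

theorem Zop_eq (Z : Fin n → Fin m → (Fin n → ℝ) × (Fin m → ℝ) → ℝ) (i : Fin n)
    (g : (Fin n → ℝ) × (Fin m → ℝ) → ℝ) (hg : Differentiable ℝ g) (p) :
    Zop Z i g p = fderiv ℝ g p (Pi.single i 1, fun σ => Z i σ p) := by
  unfold Zop
  have h : ((Pi.single i 1, fun σ => Z i σ p) : (Fin n → ℝ) × (Fin m → ℝ))
      = (Pi.single i 1, 0) + ∑ σ, Z i σ p • ((0, Pi.single σ 1) : (Fin n → ℝ) × (Fin m → ℝ)) := by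
    ext a
    · simp [Prod.fst_sum]
    · simp [Prod.snd_sum, Finset.sum_apply, Pi.single_apply]
  rw [h, map_add, map_sum, qdx_eq i g hg]
  simp only [map_smul, smul_eq_mul, qdy_eq _ g hg]

theorem Gammaop_eq (F : Fin n → Fin n → Fin m →
      (Fin n → ℝ) × (Fin m → ℝ) × (Fin n → Fin m → ℝ) → ℝ) (i : Fin n)
    (f : (Fin n → ℝ) × (Fin m → ℝ) × (Fin n → Fin m → ℝ) → ℝ) (hf : Differentiable ℝ f) (w) :
    Gammaop F i f w = fderiv ℝ f w (Pi.single i 1, w.2.2 i, fun j σ => F i j σ w) := by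
  unfold Gammaop
  have h : ((Pi.single i 1, w.2.2 i, fun j σ => F i j σ w) :
      (Fin n → ℝ) × (Fin m → ℝ) × (Fin n → Fin m → ℝ))
      = (Pi.single i 1, 0, 0)
        + ∑ σ, w.2.2 i σ • ((0, Pi.single σ 1, 0) :
          (Fin n → ℝ) × (Fin m → ℝ) × (Fin n → Fin m → ℝ))
        + ∑ j, ∑ σ, F i j σ w • ((0, 0, Pi.single j (Pi.single σ 1)) :
          (Fin n → ℝ) × (Fin m → ℝ) × (Fin n → Fin m → ℝ)) := by
    ext a b
    · simp [Prod.fst_sum]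
    · simp [Prod.snd_sum, Prod.fst_sum, Finset.sum_apply, Pi.single_apply]
    · simp only [Prod.snd_add, Prod.snd_sum, Prod.smul_snd, Pi.add_apply, Finset.sum_apply,
        Pi.smul_apply, smul_eq_mul, Pi.zero_apply, mul_zero, Finset.sum_const_zero, zero_add]
      rw [Finset.sum_eq_single a]
      · simp [Pi.single_apply]
      · intro c _ hc
        simp [Pi.single_eq_of_ne hc.symm]
      · simp
  rw [h, map_add, map_add, map_sum, map_sum, pdx_eq i f hf]
  simp only [map_sum, map_smul, smul_eq_mul, pdy_eq _ f hf, pdyj_eq _ _ f hf]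

theorem Zop_comp_sec (F : Fin n → Fin n → Fin m →
      (Fin n → ℝ) × (Fin m → ℝ) × (Fin n → Fin m → ℝ) → ℝ)
    (Z : Fin n → Fin m → (Fin n → ℝ) × (Fin m → ℝ) → ℝ)
    (hZ : ∀ i σ, Differentiable ℝ (Z i σ))
    (hemb : ∀ i j σ p, Zop Z i (Z j σ) p = F i j σ (sec Z p))
    (i : Fin n)
    (f : (Fin n → ℝ) × (Fin m → ℝ) × (Fin n → Fin m → ℝ) → ℝ) (hf : Differentiable ℝ f) (p) :
    Differentiable ℝ (fun q => f (sec Z q)) ∧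
    Zop Z i (fun q => f (sec Z q)) p = Gammaop F i f (sec Z p) := by
  have hs : ∀ q, HasFDerivAt (sec Z) ((ContinuousLinearMap.fst ℝ (Fin n → ℝ) (Fin m → ℝ)).prod
      ((ContinuousLinearMap.snd ℝ (Fin n → ℝ) (Fin m → ℝ)).prod
        (ContinuousLinearMap.pi fun j => ContinuousLinearMap.pi fun ν => fderiv ℝ (Z j ν) q))) q := by
    intro q
    refine hasFDerivAt_fst.prodMk (hasFDerivAt_snd.prodMk ?_)
    exact hasFDerivAt_pi.2 fun j => hasFDerivAt_pi.2 fun ν => (hZ j ν q).hasFDerivAt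
  have hd : ∀ q, HasFDerivAt (fun q => f (sec Z q)) _ q :=
    fun q => (hf (sec Z q)).hasFDerivAt.comp q (hs q)
  have hdd : Differentiable ℝ (fun q => f (sec Z q)) := fun q => (hd q).differentiableAt
  refine ⟨hdd, ?_⟩
  rw [Zop_eq Z i _ hdd, Gammaop_eq F i f hf, (hd p).fderiv, ContinuousLinearMap.comp_apply]
  congr 1
  refine Prod.ext rfl (Prod.ext rfl ?_)
  funext j ν
  change fderiv ℝ (Z j ν) p _ = _
  rw [← Zop_eq Z i _ (hZ j ν), hemb]

theorem Zop_qdy (Z : Fin n → Fin m → (Fin n → ℝ) × (Fin m → ℝ) → ℝ)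
    (hZ : ∀ i σ, ContDiff ℝ (⊤ : ℕ∞) (Z i σ)) (i : Fin n) (ρ : Fin m)
    (g : (Fin n → ℝ) × (Fin m → ℝ) → ℝ) (hg : ContDiff ℝ (⊤ : ℕ∞) g) (p) :
    Differentiable ℝ (qdy ρ g) ∧
    Zop Z i (qdy ρ g) p
      = qdy ρ (Zop Z i g) p - ∑ σ, qdy ρ (Z i σ) p * qdy σ g p := by
  have hgd : Differentiable ℝ g := hg.differentiable (by simp)
  have hZd : ∀ i σ, Differentiable ℝ (Z i σ) := fun i σ => (hZ i σ).differentiable (by simp)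
  have hg' : Differentiable ℝ (fderiv ℝ g) :=
    (hg.fderiv_right (m := 1) (by norm_cast)).differentiable (by simp)
  have e1 : qdy ρ g = fun p => fderiv ℝ g p (0, Pi.single ρ 1) := funext (qdy_eq ρ g hgd)
  have e2 : Zop Z i g = fun p => fderiv ℝ g p (Pi.single i 1, fun σ => Z i σ p) :=
    funext (Zop_eq Z i g hgd)
  have hd1 : ∀ q, HasFDerivAt (fun p => fderiv ℝ g p (0, Pi.single ρ 1)) _ q :=
    fun q => (hg' q).hasFDerivAt.clm_apply (hasFDerivAt_const _ q)
  have hV : ∀ q, HasFDerivAt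
      (fun p => ((Pi.single i 1, fun σ => Z i σ p) : (Fin n → ℝ) × (Fin m → ℝ)))
      ((0 : (Fin n → ℝ) × (Fin m → ℝ) →L[ℝ] (Fin n → ℝ)).prod
        (ContinuousLinearMap.pi fun σ => fderiv ℝ (Z i σ) q)) q := fun q =>
    (hasFDerivAt_const _ q).prodMk (hasFDerivAt_pi.2 fun σ => (hZd i σ q).hasFDerivAt)
  have hd2 : ∀ q, HasFDerivAt (fun p => fderiv ℝ g p (Pi.single i 1, fun σ => Z i σ p)) _ q :=
    fun q => (hg' q).hasFDerivAt.clm_apply (hV q)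
  have hq1 : Differentiable ℝ (fun p => fderiv ℝ g p ((0, Pi.single ρ 1) :
    (Fin n → ℝ) × (Fin m → ℝ))) := fun q => (hd1 q).differentiableAt
  have hq2 : Differentiable ℝ (fun p => fderiv ℝ g p ((Pi.single i 1, fun σ => Z i σ p) :
    (Fin n → ℝ) × (Fin m → ℝ))) := fun q => (hd2 q).differentiableAt
  have hsym : IsSymmSndFDerivAt ℝ g p :=
    hg.contDiffAt.isSymmSndFDerivAt (by simp [minSmoothness_of_isRCLikeNormedField]; norm_cast)
  have h : ((0, fun σ => qdy ρ (Z i σ) p) : (Fin n → ℝ) × (Fin m → ℝ))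
      = ∑ σ, qdy ρ (Z i σ) p • ((0, Pi.single σ 1) : (Fin n → ℝ) × (Fin m → ℝ)) := by
    ext a
    · simp [Prod.fst_sum]
    · simp [Prod.snd_sum, Finset.sum_apply, Pi.single_apply]
  have hsum : ∑ σ, qdy ρ (Z i σ) p * qdy σ g p
      = fderiv ℝ g p (0, fun σ => qdy ρ (Z i σ) p) := by
    rw [h, map_sum]
    simp only [map_smul, smul_eq_mul, qdy_eq _ g hgd]
  refine ⟨e1 ▸ hq1, ?_⟩
  rw [hsum, e1, e2, Zop_eq Z i _ hq1, qdy_eq ρ _ hq2, (hd1 p).fderiv, (hd2 p).fderiv]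
  have hv : ((0 : (Fin n → ℝ) × (Fin m → ℝ) →L[ℝ] (Fin n → ℝ)).prod
        (ContinuousLinearMap.pi fun σ => fderiv ℝ (Z i σ) p)) (0, Pi.single ρ 1)
      = (0, fun σ => qdy ρ (Z i σ) p) := by
    refine Prod.ext rfl ?_
    funext σ
    exact (qdy_eq ρ _ (hZd i σ) p).symm
  simp only [add_apply, ContinuousLinearMap.comp_apply,
    ContinuousLinearMap.flip_apply, zero_apply, map_zero, hv]
  rw [hsym.eq]
  ring

theorem Hfun_diff [NeZero n]
    (F : Fin n → Fin n → Fin m →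
      (Fin n → ℝ) × (Fin m → ℝ) × (Fin n → Fin m → ℝ) → ℝ)
    (hF : ∀ i j σ, ContDiff ℝ (⊤ : ℕ∞) (F i j σ))
    (v : Fin n → (Fin n → ℝ) → ℝ) (hv : ∀ i, ContDiff ℝ (⊤ : ℕ∞) (v i))
    (σ : Fin m) (k : Fin n) (ν : Fin m) : Differentiable ℝ (Hfun F v σ k ν) := by
  have hv' : ∀ i, Differentiable ℝ (v i) := fun i => (hv i).differentiable (by simp)
  have hp : ∀ i j, Differentiable ℝ (pdyj 0 σ (F i j ν)) := by
    intro i j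
    have e : pdyj 0 σ (F i j ν) = fun w => fderiv ℝ (F i j ν) w
        (0, 0, Pi.single 0 (Pi.single σ 1)) :=
      funext (pdyj_eq 0 σ _ ((hF i j ν).differentiable (by simp)))
    have h' : Differentiable ℝ (fderiv ℝ (F i j ν)) :=
      ((hF i j ν).fderiv_right (m := 1) (by norm_cast)).differentiable (by simp)
    rw [e]
    fun_prop
  unfold Hfun
  split_ifs <;> fun_prop

end Helpers

/-- **Third Main Theorem (Theorem 3.4.4) in adapted coordinates.** The total
shape operator satisfies `[[Z, Â_Z]] = −A² − Z ∧ Φ`: as an equality of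
coefficients of `dx^i ∧ dx^k`, the expression `E(i,k)` is symmetric under
interchange of `i` and `k`. -/
theorem third_main_theorem
    (n m : ℕ)
    (F : Fin (n + 2) → Fin (n + 2) → Fin (m + 1) →
      (Fin (n + 2) → ℝ) × (Fin (m + 1) → ℝ) × (Fin (n + 2) → Fin (m + 1) → ℝ) → ℝ)
    (hF : ∀ i j σ, ContDiff ℝ (⊤ : ℕ∞) (F i j σ))
    (hFsymm : ∀ i j σ, F i j σ = F j i σ)
    (Z : Fin (n + 2) → Fin (m + 1) → (Fin (n + 2) → ℝ) × (Fin (m + 1) → ℝ) → ℝ)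
    (hZ : ∀ i σ, ContDiff ℝ (⊤ : ℕ∞) (Z i σ))
    (hemb : ∀ i j σ p, Zop Z i (Z j σ) p = F i j σ (sec Z p))
    (v : Fin (n + 2) → (Fin (n + 2) → ℝ) → ℝ)
    (hv : ∀ i, ContDiff ℝ (⊤ : ℕ∞) (v i))
    (hv1 : ∀ x, v 0 x = 1) :
    ∀ (i k : Fin (n + 2)) (ρ ν : Fin (m + 1))
      (p : (Fin (n + 2) → ℝ) × (Fin (m + 1) → ℝ)),
      Ecomp F v Z i k ρ ν p = Ecomp F v Z k i ρ ν p := by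
  intro i k ρ ν p
  have hZd : ∀ i σ, Differentiable ℝ (Z i σ) := fun i σ => (hZ i σ).differentiable (by simp)
  -- the key expansion of `E(i,k)`
  have key : ∀ i k, Ecomp F v Z i k ρ ν p
      = qdy ρ (fun q => F i k ν (sec Z q)) p - Hop (Hfun F v) ρ (F i k ν) (sec Z p)
        + ∑ σ, (- qdy ρ (Z k σ) p * qdy σ (Z i ν) p - qdy ρ (Z i σ) p * qdy σ (Z k ν) p
          + Hfun F v ρ k σ (sec Z p) * qdy σ (Z i ν) p
          + Hfun F v ρ i σ (sec Z p) * qdy σ (Z k ν) p) := by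
    intro i k
    obtain ⟨hd1, h1⟩ := Zop_qdy Z hZ i ρ (Z k ν) (hZ k ν) p
    obtain ⟨hd2, h2⟩ := Zop_comp_sec F Z hZd hemb i (Hfun F v ρ k ν)
      (Hfun_diff F hF v hv ρ k ν) p
    have e : Zop Z i (Z k ν) = fun q => F i k ν (sec Z q) := funext (hemb i k ν)
    have h3 : Zop Z i (Acomp F v Z ρ k ν) p
        = Zop Z i (qdy ρ (Z k ν)) p - Zop Z i (fun q => Hfun F v ρ k ν (sec Z q)) p := by
      have e3 : Acomp F v Z ρ k ν = fun q => qdy ρ (Z k ν) q - Hfun F v ρ k ν (sec Z q) := rfl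
      rw [e3, Zop_eq Z i _ (hd1.fun_sub hd2), Zop_eq Z i _ hd1, Zop_eq Z i _ hd2,
        fderiv_fun_sub (hd1 p) (hd2 p)]
      rfl
    unfold Ecomp Phibar
    rw [h3, h1, h2, e]
    have hs : ∀ a b c : ℝ, ∀ S T U V W X : Fin (m + 1) → ℝ,
        (∀ σ, - S σ + T σ - U σ + V σ - W σ = X σ) →
        a - ∑ σ, S σ - b + ∑ σ, T σ - ∑ σ, U σ + (b - c + ∑ σ, V σ) - ∑ σ, W σ
          = a - c + ∑ σ, X σ := by
      intro a b c S T U V W X h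
      simp only [← h, Finset.sum_add_distrib, Finset.sum_sub_distrib, Finset.sum_neg_distrib]
      ring
    apply hs
    intro σ
    unfold Acomp
    ring
  rw [key i k, key k i, hFsymm k i ν]
  congr 1
  refine Finset.sum_congr rfl fun σ _ => ?_
  ring
end
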